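/- arXiv:1509.06510 — 2 statements merged into one kernel-verified Lean document; each statement's English description precedes it below -/
import Mathlib

section
/- Let k be an algebraically closed field of characteristic zero, R = k[x_0,...,x_n], F homogeneous of degree d ≥ 2 containing x_0^d as a monomial summand, and S = R/(F). Let v* = (x_0, -x_1, ..., (-1)^n x_n) in S. Then the Koszul complex K^•(v*; S) has cohomology: H^0 ≅ k (in internal degree 0), H^{-1} ≅ k concentrated in internal degree d-1 and generated by the class of the element u* = (∂F/∂x_0, -∂F/∂x_1, ..., (-1)^n ∂F/∂x_n), and H^i = 0 for all i ≠ 0, -1. -/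
/-!
STATEMENT 5. Let `k` be an algebraically closed field of characteristic zero,
`R = k[x_0,…,x_n]`, `F` homogeneous of degree `d ≥ 2` containing `x_0^d` as a
monomial summand, and `S = R/(F)`.  Let `v* = (x_0, -x_1, …, (-1)^n x_n)` in
`S`.  Then the Koszul complex `K^•(v*; S)` has cohomology: `H^0 ≅ k` (in
internal degree `0`), `H^{-1} ≅ k` (concentrated in internal degree `d-1`)
generated by the class of `u* = (∂F/∂x_0, -∂F/∂x_1, …, (-1)^n ∂F/∂x_n)`, and
`H^i = 0` for all `i ≠ 0, -1`.

The Koszul cochain complex is modeled on coefficient functions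
`Finset (Fin (n+1)) → S` (value at `s` = coefficient of `e_s`), with
contraction differential; the component `K^{-p}` consists of functions
supported on finsets of cardinality `p`.
`H^0 ≅ k` is expressed as: every `a ∈ S` is, modulo coboundaries, uniquely of
the form `algebraMap k S c`; `H^{-1} ≅ k·[u*]` as: `u*` is a `1`-cocycle and
every `1`-cocycle is, modulo coboundaries, a unique `k`-multiple of `u*`
(the internal degree `d-1` being carried by the generator `u*`);
`H^{-p} = 0` for `p ≥ 2` as: every `p`-cocycle is a coboundary.
-/

open Finset MvPolynomial

/-- The Koszul (contraction) differential on coefficient functions. -/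
noncomputable def koszulContraction {S : Type*} [CommRing S] {n : ℕ}
    (w : Fin (n + 1) → S) (f : Finset (Fin (n + 1)) → S) :
    Finset (Fin (n + 1)) → S :=
  fun s => ∑ i ∈ sᶜ, (-1 : S) ^ (s.filter (· < i)).card * w i * f (insert i s)

section aux
variable {k : Type*} [Field k] {n : ℕ}

noncomputable def eps {S : Type*} [CommRing S] (i : Fin (n+1)) (s : Finset (Fin (n+1))) : S :=
  (-1 : S) ^ (s.filter (· < i)).card

lemma eps_sq {S : Type*} [CommRing S] (i : Fin (n+1)) (s : Finset (Fin (n+1))) :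
    (eps i s : S) * eps i s = 1 := by
  unfold eps; rw [← mul_pow]; simp

lemma sg_sq {S : Type*} [CommRing S] (i : ℕ) : ((-1 : S))^i * (-1)^i = 1 := by
  rw [← mul_pow]; simp

lemma eps_insert {S : Type*} [CommRing S] (i j : Fin (n+1)) (s : Finset (Fin (n+1)))
    (h : i ∉ s) : (eps j (insert i s) : S) = (if i < j then -1 else 1) * eps j s := by
  unfold eps
  rw [Finset.filter_insert]
  split_ifs with h1
  · rw [Finset.card_insert_of_notMem (by simp [h]), pow_succ]; ring
  · simp

lemma eps_swap {S : Type*} [CommRing S] (i j : Fin (n+1)) (s : Finset (Fin (n+1)))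
    (hi : i ∉ s) (hj : j ∉ s) (hij : i ≠ j) :
    (eps i s : S) * eps j (insert i s) = - (eps j s * eps i (insert j s)) := by
  rw [eps_insert i j s hi, eps_insert j i s hj]
  rcases lt_or_gt_of_ne hij with h | h
  · simp [h, h.not_gt]; ring
  · simp [h, h.not_gt]; ring

lemma kc_apply {S : Type*} [CommRing S] (w : Fin (n + 1) → S) (f : Finset (Fin (n + 1)) → S)
    (s) : koszulContraction w f s = ∑ i ∈ sᶜ, eps i s * w i * f (insert i s) := rfl

lemma kc_supp {S : Type*} [CommRing S] (w : Fin (n + 1) → S) (f : Finset (Fin (n + 1)) → S)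
    (p : ℕ) (hf : ∀ s, s.card ≠ p → f s = 0) (s) (hs : s.card + 1 ≠ p) :
    koszulContraction w f s = 0 := by
  rw [kc_apply]
  refine Finset.sum_eq_zero fun i hi => ?_
  rw [hf, mul_zero]
  rwa [Finset.card_insert_of_notMem (by simpa using hi)]

lemma kc_map {S T : Type*} [CommRing S] [CommRing T] (φ : S →+* T) (w : Fin (n + 1) → S)
    (f : Finset (Fin (n + 1)) → S) (s) :
    φ (koszulContraction w f s) = koszulContraction (fun i => φ (w i)) (fun t => φ (f t)) s := by
  simp [koszulContraction]

lemma kc_add {S : Type*} [CommRing S] (w : Fin (n + 1) → S) (f g : Finset (Fin (n + 1)) → S) (s) :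
    koszulContraction w (fun t => f t + g t) s =
      koszulContraction w f s + koszulContraction w g s := by
  simp [koszulContraction, mul_add, Finset.sum_add_distrib]

lemma kc_mul {S : Type*} [CommRing S] (w : Fin (n + 1) → S) (c : S)
    (g : Finset (Fin (n + 1)) → S) (s) :
    koszulContraction w (fun t => c * g t) s = c * koszulContraction w g s := by
  simp only [koszulContraction, Finset.mul_sum]
  exact Finset.sum_congr rfl fun _ _ => by ring

lemma kc_sum {S ι : Type*} [CommRing S] (w : Fin (n + 1) → S) (a : Finset ι)
    (g : ι → Finset (Fin (n + 1)) → S) (s) :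
    koszulContraction w (fun t => ∑ m ∈ a, g m t) s = ∑ m ∈ a, koszulContraction w (g m) s := by
  simp only [koszulContraction, Finset.mul_sum]
  rw [Finset.sum_comm]

lemma kc_kc {S : Type*} [CommRing S] [IsDomain S] [CharZero S] (w : Fin (n + 1) → S)
    (f : Finset (Fin (n + 1)) → S) (s) :
    koszulContraction w (koszulContraction w f) s = 0 := by
  have key : koszulContraction w (koszulContraction w f) s =
      ∑ i ∈ sᶜ, ∑ j ∈ sᶜ, if i = j then 0 else
        eps i s * eps j (insert i s) * (w i * w j * f (insert j (insert i s))) := by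
    rw [kc_apply]
    refine Finset.sum_congr rfl fun i hi => ?_
    rw [kc_apply, Finset.compl_insert, ← Finset.add_sum_erase (sᶜ) _ hi, if_pos rfl, zero_add,
      Finset.mul_sum]
    refine Finset.sum_congr rfl fun j hj => ?_
    rw [if_neg (Finset.ne_of_mem_erase hj).symm]; ring
  have h2 : koszulContraction w (koszulContraction w f) s =
      - koszulContraction w (koszulContraction w f) s := by
    conv_lhs => rw [key, Finset.sum_comm]
    rw [key, ← Finset.sum_neg_distrib]
    refine Finset.sum_congr rfl fun i hi => ?_
    rw [← Finset.sum_neg_distrib]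
    refine Finset.sum_congr rfl fun j hj => ?_
    by_cases h : i = j
    · simp [h]
    · rw [if_neg h, if_neg (Ne.symm h), eps_swap i j s (by simpa using hi) (by simpa using hj) h,
        Finset.insert_comm]; ring
  exact self_eq_neg.mp h2

/-- weights -/
noncomputable def wt (k : Type*) [Field k] (n : ℕ) (i : Fin (n+1)) : MvPolynomial (Fin (n + 1)) k :=
  (-1)^(i:ℕ) * X i

/-- de Rham differential -/
noncomputable def dR (f : Finset (Fin (n + 1)) → MvPolynomial (Fin (n + 1)) k) :
    Finset (Fin (n + 1)) → MvPolynomial (Fin (n + 1)) k :=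
  fun t => ∑ j ∈ t, (-1)^(j:ℕ) * eps j (t.erase j) * pderiv j (f (t.erase j))

lemma pd_sign (j : Fin (n+1)) (m : ℕ) (q : MvPolynomial (Fin (n + 1)) k) :
    pderiv j ((-1)^m * q) = (-1)^m * pderiv j q := by
  rcases neg_one_pow_eq_or (MvPolynomial (Fin (n + 1)) k) m with h | h <;> simp [h]

lemma pd_eps (j i : Fin (n+1)) (s) (q : MvPolynomial (Fin (n + 1)) k) :
    pderiv j (eps i s * q) = eps i s * pderiv j q := pd_sign _ _ _

set_option maxHeartbeats 1000000 in
lemma homotopy (f : Finset (Fin (n + 1)) → MvPolynomial (Fin (n + 1)) k) (s) :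
    koszulContraction (wt k n) (dR f) s + dR (koszulContraction (wt k n) f) s =
      ∑ i, X i * pderiv i (f s) + s.card * f s := by
  have h1 : koszulContraction (wt k n) (dR f) s = ∑ i ∈ sᶜ, X i * pderiv i (f s) +
      ∑ i ∈ sᶜ, ∑ j ∈ s, (eps i s * eps j ((insert i s).erase j)) *
        (wt k n i * (-1)^(j:ℕ) * pderiv j (f ((insert i s).erase j))) := by
    rw [kc_apply, ← Finset.sum_add_distrib]
    refine Finset.sum_congr rfl fun i hi => ?_
    have hi' : i ∉ s := by simpa using hi
    rw [dR, Finset.sum_insert hi', Finset.erase_insert hi', mul_add, Finset.mul_sum]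
    refine congrArg₂ (· + ·) ?_ ?_
    · unfold wt
      linear_combination (X i * pderiv i (f s)) * (eps i s * eps i s * sg_sq (S := MvPolynomial (Fin (n + 1)) k) (i:ℕ) + eps_sq (S := MvPolynomial (Fin (n + 1)) k) i s)
    · refine Finset.sum_congr rfl fun j hj => by ring
  have h2 : dR (koszulContraction (wt k n) f) s = ∑ i ∈ s, (X i * pderiv i (f s) + f s) +
      ∑ j ∈ s, ∑ i ∈ sᶜ, (eps j (s.erase j) * eps i (s.erase j)) *
        (wt k n i * (-1)^(j:ℕ) * pderiv j (f (insert i (s.erase j)))) := by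
    rw [dR, ← Finset.sum_add_distrib]
    refine Finset.sum_congr rfl fun j hj => ?_
    rw [kc_apply, Finset.compl_erase, Finset.sum_insert (by simpa using hj), map_add, map_sum,
      mul_add, Finset.mul_sum]
    refine congrArg₂ (· + ·) ?_ ?_
    · rw [Finset.insert_erase hj, wt, mul_assoc, mul_assoc, pd_eps, mul_assoc (_ ^ _) (X _) (f _), pd_sign, Derivation.leibniz]
      simp only [smul_eq_mul, pderiv_X_self]
      linear_combination (X j * pderiv j (f s) + f s) * (eps j (s.erase j) * eps j (s.erase j) * sg_sq (S := MvPolynomial (Fin (n + 1)) k) (j:ℕ) + eps_sq (S := MvPolynomial (Fin (n + 1)) k) j (s.erase j))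
    · refine Finset.sum_congr rfl fun i hi => ?_
      have hij : i ≠ j := by rintro rfl; simp at hi; exact hi hj
      rw [wt, mul_assoc, mul_assoc, pd_eps, mul_assoc (_ ^ _) (X _) (f _), pd_sign, Derivation.leibniz, pderiv_X_of_ne hij]
      simp only [smul_eq_mul]
      ring
  rw [h1, h2, Finset.sum_comm (s := s) (t := sᶜ), Finset.sum_add_distrib,
    ← Finset.sum_compl_add_sum s]
  have h3 : ∑ i ∈ sᶜ, ∑ j ∈ s, (eps i s * eps j ((insert i s).erase j)) *
        (wt k n i * (-1)^(j:ℕ) * pderiv j (f ((insert i s).erase j))) = 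
      - ∑ i ∈ sᶜ, ∑ j ∈ s, (eps j (s.erase j) * eps i (s.erase j)) *
        (wt k n i * (-1)^(j:ℕ) * pderiv j (f (insert i (s.erase j)))) := by
    rw [← Finset.sum_neg_distrib]
    refine Finset.sum_congr rfl fun i hi => ?_
    rw [← Finset.sum_neg_distrib]
    refine Finset.sum_congr rfl fun j hj => ?_
    have hi' : i ∉ s := by simpa using hi
    have hij : i ≠ j := by rintro rfl; exact hi' hj
    rw [Finset.erase_insert_of_ne hij]
    obtain ⟨t, ht, rfl⟩ : ∃ t, j ∉ t ∧ s = insert j t := 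
      ⟨s.erase j, by simp, (Finset.insert_erase hj).symm⟩
    rw [Finset.erase_insert ht, mul_comm (eps i _) (eps j _), eps_insert i j t (by simp at hi'; tauto),
      eps_insert j i t ht]
    rcases lt_or_gt_of_ne hij with h | h
    · simp [h, h.not_gt]
    · simp [h, h.not_gt]
  rw [h3]
  simp only [Finset.sum_const, nsmul_eq_mul]
  ring

lemma dR_supp (f : Finset (Fin (n + 1)) → MvPolynomial (Fin (n + 1)) k)
    (p : ℕ) (hf : ∀ s, s.card ≠ p → f s = 0) (s) (hs : s.card ≠ p + 1) : dR f s = 0 := by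
  refine Finset.sum_eq_zero fun j hj => ?_
  rw [hf, map_zero, mul_zero]
  have := Finset.card_erase_add_one hj
  omega

lemma dR_zero (s) : dR (0 : Finset (Fin (n + 1)) → MvPolynomial (Fin (n + 1)) k) s = 0 := by
  simp [dR]

end aux

section aux2
variable {k : Type*} [Field k] {n : ℕ}

lemma hc_X_mul (m : ℕ) (i : Fin (n+1)) (q : MvPolynomial (Fin (n + 1)) k) :
    homogeneousComponent (m+1) (X i * q) = X i * homogeneousComponent m q := by
  ext d
  rw [coeff_homogeneousComponent, coeff_X_mul', coeff_X_mul', coeff_homogeneousComponent]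
  by_cases hi : i ∈ d.support
  · rw [if_pos hi, if_pos hi]
    have h1 : Finsupp.single i 1 ≤ d := by
      rw [Finsupp.single_le_iff]
      have := Finsupp.mem_support_iff.mp hi
      omega
    have h2 : d.degree = (d - Finsupp.single i 1).degree + 1 := by
      conv_lhs => rw [← tsub_add_cancel_of_le h1]
      simp
    rw [h2]; simp
  · simp [hi]

lemma hc_sign (m a : ℕ) (q : MvPolynomial (Fin (n + 1)) k) :
    homogeneousComponent m ((-1)^a * q) = (-1)^a * homogeneousComponent m q := by
  rcases neg_one_pow_eq_or (MvPolynomial (Fin (n + 1)) k) a with h | h <;> simp [h]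

lemma hc_kc (m : ℕ) (f : Finset (Fin (n + 1)) → MvPolynomial (Fin (n + 1)) k) (s) :
    homogeneousComponent (m+1) (koszulContraction (wt k n) f s) =
      koszulContraction (wt k n) (fun t => homogeneousComponent m (f t)) s := by
  simp only [koszulContraction, wt, map_sum, mul_assoc, hc_sign, hc_X_mul]

lemma acyclic [CharZero k] (p : ℕ) (f : Finset (Fin (n + 1)) → MvPolynomial (Fin (n + 1)) k)
    (hf : ∀ s, s.card ≠ p → f s = 0) (hp : p = 0 → ∀ s, coeff 0 (f s) = 0)
    (hd : ∀ s, koszulContraction (wt k n) f s = 0) :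
    ∃ g : Finset (Fin (n + 1)) → MvPolynomial (Fin (n + 1)) k,
      (∀ s, s.card ≠ p + 1 → g s = 0) ∧ ∀ s, f s = koszulContraction (wt k n) g s := by
  let fm : ℕ → Finset (Fin (n + 1)) → MvPolynomial (Fin (n + 1)) k :=
    fun m t => homogeneousComponent m (f t)
  have hfm : ∀ m s, s.card ≠ p → fm m s = 0 := fun m s hs => by simp [fm, hf s hs]
  have key : ∀ m s, koszulContraction (wt k n) (dR (fm m)) s = C ((m + p : ℕ) : k) * fm m s := by
    intro m s
    have h := homotopy (fm m) s
    have h0 : koszulContraction (wt k n) (fm m) = 0 := by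
      funext t
      have := hc_kc m f t
      rw [hd t, map_zero] at this
      exact this.symm
    rw [h0, dR_zero, add_zero,
      (homogeneousComponent_isHomogeneous m (f s)).sum_X_mul_pderiv] at h
    rw [h]
    by_cases hs : s.card = p
    · simp [hs, fm, add_mul]
    · have h0 := hfm m s hs
      rw [show homogeneousComponent m (f s) = fm m s from rfl, h0]
      simp
  let N := Finset.univ.sup (fun t => (f t).totalDegree) + 1
  refine ⟨fun t => ∑ m ∈ Finset.range N, C (((m + p : ℕ) : k)⁻¹) * dR (fm m) t, ?_, ?_⟩
  · intro s hs
    refine Finset.sum_eq_zero fun m _ => ?_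
    rw [dR_supp (fm m) p (hfm m) s hs, mul_zero]
  · intro s
    rw [kc_sum]
    have h1 : ∀ m ∈ Finset.range N, koszulContraction (wt k n)
        (fun t => C (((m + p : ℕ) : k)⁻¹) * dR (fm m) t) s = fm m s := by
      intro m _
      rw [kc_mul, key, ← mul_assoc, ← C_mul]
      by_cases h : m + p = 0
      · have : fm m s = 0 := by
          obtain ⟨rfl, rfl⟩ : m = 0 ∧ p = 0 := by omega
          simp [fm, hp rfl s]
        simp [this]
      · rw [inv_mul_cancel₀ (by exact_mod_cast h)]; simp
    rw [Finset.sum_congr rfl h1]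
    have h2 : (f s).totalDegree ≤ Finset.univ.sup (fun t => (f t).totalDegree) :=
      Finset.le_sup (f := fun t => (f t).totalDegree) (Finset.mem_univ s)
    conv_lhs => rw [← sum_homogeneousComponent (f s)]
    refine Finset.sum_subset ?_ ?_
    · intro x; simp [N]; omega
    · intro x _ hx
      apply homogeneousComponent_eq_zero
      simp at hx; omega

lemma coeff_kc (g : Finset (Fin (n + 1)) → MvPolynomial (Fin (n + 1)) k) (s) :
    constantCoeff (koszulContraction (wt k n) g s) = 0 := by
  simp [koszulContraction, wt]

/-- decomposition in degree zero -/
lemma deg_zero [CharZero k] (a : MvPolynomial (Fin (n + 1)) k) :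
    ∃ g : Finset (Fin (n + 1)) → MvPolynomial (Fin (n + 1)) k,
      (∀ s, s.card ≠ 1 → g s = 0) ∧
        a = C (constantCoeff a) + koszulContraction (wt k n) g ∅ := by
  have hf : ∀ s : Finset (Fin (n+1)), s.card ≠ 0 →
      (fun s : Finset (Fin (n+1)) => if s.card = 0 then a - C (constantCoeff a) else 0) s = 0 := by
    intro s hs; simp only [if_neg hs]
  obtain ⟨g, hg, hg2⟩ := acyclic 0
    (fun s : Finset (Fin (n+1)) => if s.card = 0 then a - C (constantCoeff a) else 0)
    hf (by intro _ s; split_ifs <;> simp [constantCoeff_eq])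
    (fun s => kc_supp _ _ 0 hf s (by omega))
  refine ⟨g, hg, ?_⟩
  rw [← hg2 ∅]; simp

/-- lift of `u*` -/
noncomputable def uu (F : MvPolynomial (Fin (n + 1)) k) (s : Finset (Fin (n + 1))) :
    MvPolynomial (Fin (n + 1)) k :=
  if s.card = 1 then ∑ i ∈ s, (-1) ^ (i : ℕ) * pderiv i F else 0

lemma uu_supp (F : MvPolynomial (Fin (n + 1)) k) (s) (hs : s.card ≠ 1) : uu F s = 0 := by
  simp [uu, hs]

lemma kc_uu {d : ℕ} (F : MvPolynomial (Fin (n + 1)) k) (hF : F.IsHomogeneous d) (s) :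
    koszulContraction (wt k n) (uu F) s = if s = ∅ then (C (d : k)) * F else 0 := by
  split_ifs with h
  · subst h
    have := hF.sum_X_mul_pderiv
    rw [nsmul_eq_mul] at this
    simp only [map_natCast]
    rw [← this, kc_apply, Finset.compl_empty]
    refine Finset.sum_congr rfl fun i _ => ?_
    simp only [eps, wt, uu, Finset.filter_empty, Finset.card_empty, pow_zero, insert_empty_eq,
      Finset.card_singleton, if_true, Finset.sum_singleton]
    linear_combination (X i * pderiv i F) * sg_sq (S := MvPolynomial (Fin (n + 1)) k) (i:ℕ)
  · apply kc_supp _ _ 1 (uu_supp F)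
    have : s.card ≠ 0 := by simpa using h
    omega

/-- lift a cocycle to a function with `d f = F h`, `h` cocycle -/
lemma lift_cocycle [CharZero k] (F : MvPolynomial (Fin (n + 1)) k) (hF0 : F ≠ 0) (p : ℕ)
    (f : Finset (Fin (n + 1)) → (MvPolynomial (Fin (n + 1)) k ⧸ Ideal.span {F}))
    (hf : ∀ s, s.card ≠ p + 1 → f s = 0)
    (hd : koszulContraction (fun i => Ideal.Quotient.mk (Ideal.span {F}) (wt k n i)) f = 0) :
    ∃ f' h : Finset (Fin (n + 1)) → MvPolynomial (Fin (n + 1)) k,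
      (∀ s, Ideal.Quotient.mk (Ideal.span {F}) (f' s) = f s) ∧
      (∀ s, s.card ≠ p + 1 → f' s = 0) ∧ (∀ s, s.card ≠ p → h s = 0) ∧
      (∀ s, koszulContraction (wt k n) f' s = F * h s) ∧
      (∀ s, koszulContraction (wt k n) h s = 0) := by
  obtain ⟨f', hf1, hf2⟩ : ∃ f' : Finset (Fin (n + 1)) → MvPolynomial (Fin (n + 1)) k,
      (∀ s, Ideal.Quotient.mk (Ideal.span {F}) (f' s) = f s) ∧
      (∀ s, s.card ≠ p + 1 → f' s = 0) := by
    choose q hq using fun s => Ideal.Quotient.mk_surjective (f s)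
    refine ⟨fun s => if s.card = p + 1 then q s else 0, fun s => ?_, fun s hs => by simp [hs]⟩
    by_cases hs : s.card = p + 1
    · simp [hs, hq]
    · simp [hs, hf s hs]
  have h1 : ∀ s, ∃ h, koszulContraction (wt k n) f' s = F * h := by
    intro s
    have : Ideal.Quotient.mk (Ideal.span {F}) (koszulContraction (wt k n) f' s) = 0 := by
      rw [kc_map, funext hf1, hd]; rfl
    rw [Ideal.Quotient.eq_zero_iff_mem, Ideal.mem_span_singleton] at this
    exact this
  choose h hh using h1
  refine ⟨f', h, hf1, hf2, fun s hs => ?_, hh, fun s => ?_⟩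
  · have := hh s
    rw [kc_supp _ _ (p+1) hf2 s (by omega)] at this
    exact (mul_eq_zero.mp this.symm).resolve_left hF0
  · have := kc_kc (wt k n) f' s
    rw [funext hh, kc_mul] at this
    exact (mul_eq_zero.mp this).resolve_left hF0

end aux2

theorem stmt5 {k : Type*} [Field k] [CharZero k] [IsAlgClosed k] (n d : ℕ)
    (hd : 2 ≤ d) (F : MvPolynomial (Fin (n + 1)) k) (hF : F.IsHomogeneous d)
    (hx0 : F.coeff (Finsupp.single 0 d) = 1)
    (vstar : Fin (n + 1) → (MvPolynomial (Fin (n + 1)) k ⧸ Ideal.span {F}))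
    (hv : ∀ i, vstar i =
      (-1 : MvPolynomial (Fin (n + 1)) k ⧸ Ideal.span {F}) ^ (i : ℕ) *
        Ideal.Quotient.mk (Ideal.span {F}) (X i))
    (ustar : Finset (Fin (n + 1)) → (MvPolynomial (Fin (n + 1)) k ⧸ Ideal.span {F}))
    (hu : ∀ s, ustar s = if s.card = 1 then
      ∑ i ∈ s, (-1 : MvPolynomial (Fin (n + 1)) k ⧸ Ideal.span {F}) ^ (i : ℕ) *
        Ideal.Quotient.mk (Ideal.span {F}) (pderiv i F)
      else 0) :
    -- `H^0 ≅ k`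
    (∀ a : MvPolynomial (Fin (n + 1)) k ⧸ Ideal.span {F},
      ∃! c : k, ∃ g : Finset (Fin (n + 1)) → (MvPolynomial (Fin (n + 1)) k ⧸ Ideal.span {F}),
        (∀ s, s.card ≠ 1 → g s = 0) ∧
        a = algebraMap k _ c + koszulContraction vstar g ∅) ∧
    -- `u*` is a `1`-cocycle
    (koszulContraction vstar ustar = 0) ∧
    -- `H^{-1} ≅ k`, generated by the class of `u*`
    (∀ f : Finset (Fin (n + 1)) → (MvPolynomial (Fin (n + 1)) k ⧸ Ideal.span {F}),
      (∀ s, s.card ≠ 1 → f s = 0) → koszulContraction vstar f = 0 →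
      ∃! c : k, ∃ g : Finset (Fin (n + 1)) → (MvPolynomial (Fin (n + 1)) k ⧸ Ideal.span {F}),
        (∀ s, s.card ≠ 2 → g s = 0) ∧
        ∀ s, f s = algebraMap k (MvPolynomial (Fin (n + 1)) k ⧸ Ideal.span {F}) c * ustar s
          + koszulContraction vstar g s) ∧
    -- `H^{-p} = 0` for `p ≥ 2`
    (∀ p : ℕ, 2 ≤ p →
      ∀ f : Finset (Fin (n + 1)) → (MvPolynomial (Fin (n + 1)) k ⧸ Ideal.span {F}),
        (∀ s, s.card ≠ p → f s = 0) → koszulContraction vstar f = 0 →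
        ∃ g : Finset (Fin (n + 1)) → (MvPolynomial (Fin (n + 1)) k ⧸ Ideal.span {F}),
          (∀ s, s.card ≠ p + 1 → g s = 0) ∧ f = koszulContraction vstar g) := by
  have hF0 : F ≠ 0 := by rintro rfl; simp at hx0
  have hdk : (d : k) ≠ 0 := by exact_mod_cast (by omega : d ≠ 0)
  have hFc : constantCoeff F = 0 := by
    rw [constantCoeff_eq]
    exact hF.coeff_eq_zero (by simp; omega)
  obtain rfl : vstar = fun i => Ideal.Quotient.mk (Ideal.span {F}) (wt k n i) := by
    funext i; rw [hv]; simp [wt]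
  obtain rfl : ustar = fun s => Ideal.Quotient.mk (Ideal.span {F}) (uu F s) := by
    funext s; rw [hu, uu]; split_ifs <;> simp
  have hmF : Ideal.Quotient.mk (Ideal.span {F}) F = 0 :=
    Ideal.Quotient.eq_zero_iff_mem.mpr (Ideal.mem_span_singleton_self F)
  have halg : ∀ c : k, algebraMap k (MvPolynomial (Fin (n + 1)) k ⧸ Ideal.span {F}) c =
      Ideal.Quotient.mk (Ideal.span {F}) (C c) := fun c => rfl
  -- a constant whose class is a coboundary vanishes
  have hlift : ∀ g : Finset (Fin (n + 1)) → (MvPolynomial (Fin (n + 1)) k ⧸ Ideal.span {F}),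
      ∃ g' : Finset (Fin (n + 1)) → MvPolynomial (Fin (n + 1)) k,
        g = fun s => Ideal.Quotient.mk (Ideal.span {F}) (g' s) := by
    intro g
    choose g' hg' using fun s => Ideal.Quotient.mk_surjective (g s)
    exact ⟨g', funext fun s => (hg' s).symm⟩
  have hdvd : ∀ a b : MvPolynomial (Fin (n + 1)) k, Ideal.Quotient.mk (Ideal.span {F}) a =
      Ideal.Quotient.mk (Ideal.span {F}) b → ∃ h, a - b = F * h := by
    intro a b hab
    rw [Ideal.Quotient.eq, Ideal.mem_span_singleton] at hab
    exact hab
  refine ⟨?_, ?_, ?_, ?_⟩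
  · intro a
    obtain ⟨a, rfl⟩ := Ideal.Quotient.mk_surjective a
    obtain ⟨g, hg, hag⟩ := deg_zero a
    refine ⟨constantCoeff a, ⟨fun s => Ideal.Quotient.mk (Ideal.span {F}) (g s), ?_, ?_⟩, ?_⟩
    · intro s hs; simp only [hg s hs, map_zero]
    · rw [← kc_map, halg, ← map_add, ← hag]
    · rintro c ⟨g, -, hg⟩
      obtain ⟨g, rfl⟩ := hlift g
      rw [← kc_map, halg, ← map_add] at hg
      obtain ⟨h, hh⟩ := hdvd _ _ hg
      have := congrArg constantCoeff hh
      simp [coeff_kc, hFc] at this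
      exact (sub_eq_zero.mp this).symm
  · funext s
    rw [← kc_map, kc_uu F hF]
    split_ifs <;> simp [hmF]
  · intro f hf hdf
    obtain ⟨f', h, hf1, hf2, hh1, hh2, hh3⟩ := lift_cocycle F hF0 0 f hf hdf
    obtain ⟨g', hg1, hg2⟩ := deg_zero (h ∅)
    set c' := constantCoeff (h ∅) with hc'
    have hE : ∀ s : Finset (Fin (n+1)), s.card ≠ 1 →
        f' s + (-F * g' s + - C (c' / d) * uu F s) = 0 := by
      intro s hs
      rw [hf2 s hs, hg1 s hs, uu_supp F s hs]; simp
    obtain ⟨g, hg, hgd⟩ := acyclic 1 (fun s => f' s + (-F * g' s + - C (c' / d) * uu F s)) hE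
      (by simp) (by
        intro s
        by_cases hs : s = ∅
        · subst hs
          rw [kc_add, kc_add, kc_mul, kc_mul, kc_uu F hF, if_pos rfl, hh2]
          have hcd : (C (c' / d) : MvPolynomial (Fin (n+1)) k) * C (d : k) = C c' := by
            rw [← C_mul, div_mul_cancel₀ _ hdk]
          linear_combination F * hg2 - F * hcd
        · apply kc_supp _ _ 1 hE
          have : s.card ≠ 0 := by simpa using hs
          omega)
    refine ⟨c' / d, ⟨fun s => Ideal.Quotient.mk (Ideal.span {F}) (g s), ?_, ?_⟩, ?_⟩
    · intro s hs; simp only [hg s hs, map_zero]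
    · intro s
      rw [← kc_map, ← hgd s, halg, ← hf1 s]
      simp only [map_add, map_mul, map_neg, hmF]
      ring
    · rintro c ⟨g2, -, hg2⟩
      obtain ⟨g2, rfl⟩ := hlift g2
      have h4 : ∀ s, ∃ q, f' s - (C c * uu F s + koszulContraction (wt k n) g2 s) = F * q := by
        intro s
        apply hdvd
        rw [hf1, hg2 s, ← kc_map, halg, map_add, map_mul]
      choose q hq using h4
      have h5 : ∀ s, f' s = C c * uu F s + (koszulContraction (wt k n) g2 s + F * q s) := by
        intro s; rw [← hq s]; ring
      have h6 := hh2 ∅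
      rw [funext h5, kc_add, kc_add, kc_mul, kc_mul, kc_kc, kc_uu F hF, if_pos rfl] at h6
      have h7 : C c * C (d : k) + koszulContraction (wt k n) q ∅ = h ∅ := by
        apply mul_left_cancel₀ hF0
        linear_combination h6
      have h8 := congrArg constantCoeff h7
      rw [map_add, coeff_kc, map_mul, constantCoeff_C, constantCoeff_C, add_zero, ← hc'] at h8
      rw [← h8, mul_div_cancel_right₀ _ hdk]
  · intro p hp f hf hdf
    obtain ⟨p, rfl⟩ : ∃ r, p = r + 1 := ⟨p - 1, by omega⟩
    obtain ⟨f', h, hf1, hf2, hh1, hh2, hh3⟩ := lift_cocycle F hF0 p f hf hdf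
    obtain ⟨g', hg1, hg2⟩ := acyclic p h hh1 (by omega) hh3
    obtain ⟨g, hg, hgd⟩ := acyclic (p + 1) (fun s => f' s + -F * g' s)
      (by intro s hs; simp only [hf2 s hs, hg1 s hs]; simp) (by omega) (by
        intro s
        rw [kc_add, kc_mul, hh2, ← hg2]; ring)
    refine ⟨fun s => Ideal.Quotient.mk (Ideal.span {F}) (g s), ?_, ?_⟩
    · intro s hs; simp only [hg s hs, map_zero]
    · funext s
      rw [← kc_map, ← hgd s, ← hf1 s]
      simp [hmF]
end

section
/- Let k be a field of characteristic zero, R = k[x_0,x_1,x_2,x_3], and F homogeneous of degree 4 with F = x_0^4 + f_2 x_0^2 + f_3 x_0 + f_4 where f_t ∈ k[x_1,x_2,x_3] is homogeneous of degree t (i.e. the x_0^3-coefficient vanishes). Suppose ∂F/∂x_1 ≠ 0. Then the seven elements x_0·∂F/∂x_0, x_1·∂F/∂x_0, x_2·∂F/∂x_0, x_3·∂F/∂x_0, x_1·∂F/∂x_1, x_2·∂F/∂x_1, x_3·∂F/∂x_1 are linearly independent over k in R_4; consequently dim_k ( R_4 / ∑_{i,j} k x_i ∂F/∂x_j ) ≤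 28. -/
open MvPolynomial Module

theorem lin_zero {k : Type*} [Field k] (a : Fin 4 → k)
    (h : C (a 0) * X 0 + C (a 1) * X 1 + C (a 2) * X 2 + C (a 3) * X 3 = (0 : MvPolynomial (Fin 4) k)) :
    a 0 = 0 ∧ a 1 = 0 ∧ a 2 = 0 ∧ a 3 = 0 := by
  have key : ∀ i, a i = 0 := by
    intro i
    have := congrArg (MvPolynomial.eval (Pi.single i (1:k))) h
    fin_cases i <;> simpa [Pi.single_apply] using this
  exact ⟨key 0, key 1, key 2, key 3⟩

theorem hom_finite (k : Type*) [Field k] :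
    Module.Finite k (homogeneousSubmodule (Fin 4) k 4) ∧
    finrank k (homogeneousSubmodule (Fin 4) k 4) ≤ 35 := by
  classical
  set s : Finset (MvPolynomial (Fin 4) k) :=
    ((Finset.univ : Finset (Fin 4)).finsuppAntidiag 4).image (fun d => monomial d (1:k)) with hs
  have hle : homogeneousSubmodule (Fin 4) k 4 ≤ Submodule.span k (s : Set (MvPolynomial (Fin 4) k)) := by
    intro p hp
    rw [mem_homogeneousSubmodule] at hp
    rw [p.as_sum]
    refine Submodule.sum_mem _ fun d hd => ?_
    have : monomial d (coeff d p) = coeff d p • monomial d (1:k) := by simp [smul_monomial]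
    rw [this]
    refine Submodule.smul_mem _ _ (Submodule.subset_span ?_)
    rw [hs, Finset.coe_image]
    refine ⟨d, ?_, rfl⟩
    have h := hp (MvPolynomial.mem_support_iff.mp hd)
    change Finsupp.weight (fun _ => 1) d = 4 at h
    rw [← Finsupp.degree_eq_weight_one, Finsupp.degree_eq_sum] at h
    simp [Finset.mem_finsuppAntidiag, h]
  have : Module.Finite k (Submodule.span k (s : Set (MvPolynomial (Fin 4) k))) :=
    Module.Finite.span_finset k s
  refine ⟨Submodule.finiteDimensional_of_le hle, (Submodule.finrank_mono hle).trans ?_⟩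
  refine (finrank_span_finset_le_card s).trans (Finset.card_image_le.trans ?_)
  rw [Finset.card_finsuppAntidiag_nat_eq_choose]
  simp [Nat.choose]

theorem deg_zero_s9 {k : Type*} [Field k] (f : MvPolynomial (Fin 4) k)
    (h : ∀ m ∈ f.support, m 0 = 0) : degreeOf 0 f = 0 := by
  have : degreeOf 0 f ≤ 0 := by
    rw [degreeOf_le_iff]; intro m hm; exact (h m hm).le
  omega

theorem pderiv_zero {k : Type*} [Field k] (f : MvPolynomial (Fin 4) k)
    (h : ∀ m ∈ f.support, m 0 = 0) : pderiv 0 f = 0 := by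
  ext m
  rw [coeff_pderiv]
  by_cases hm : m + Finsupp.single 0 1 ∈ f.support
  · have := h _ hm
    simp at this
  · simp [notMem_support_iff.mp hm]

theorem pderiv_deg {k : Type*} [Field k] (f : MvPolynomial (Fin 4) k)
    (h : ∀ m ∈ f.support, m 0 = 0) : ∀ m ∈ (pderiv 1 f).support, m 0 = 0 := by
  intro m hm
  rw [MvPolynomial.mem_support_iff, coeff_pderiv] at hm
  have := h _ (MvPolynomial.mem_support_iff.mpr (left_ne_zero_of_mul hm))
  simpa using this

theorem stmt9 {k : Type*} [Field k] [CharZero k]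
    (f₂ f₃ f₄ : MvPolynomial (Fin 4) k)
    (h₂ : f₂.IsHomogeneous 2) (h₃ : f₃.IsHomogeneous 3) (h₄ : f₄.IsHomogeneous 4)
    (h₂x : ∀ m ∈ f₂.support, m 0 = 0) (h₃x : ∀ m ∈ f₃.support, m 0 = 0)
    (h₄x : ∀ m ∈ f₄.support, m 0 = 0)
    (F : MvPolynomial (Fin 4) k)
    (hF : F = X 0 ^ 4 + f₂ * X 0 ^ 2 + f₃ * X 0 + f₄)
    (h1 : pderiv 1 F ≠ 0)
    (W : Submodule k (MvPolynomial (Fin 4) k))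
    (hW : W = Submodule.span k
      {p : MvPolynomial (Fin 4) k | ∃ i j : Fin 4, p = X i * pderiv j F}) :
    LinearIndependent k
      ![X 0 * pderiv 0 F, X 1 * pderiv 0 F, X 2 * pderiv 0 F, X 3 * pderiv 0 F,
        X 1 * pderiv 1 F, X 2 * pderiv 1 F, X 3 * pderiv 1 F] ∧
    finrank k
      ((homogeneousSubmodule (Fin 4) k 4) ⧸
        W.comap (homogeneousSubmodule (Fin 4) k 4).subtype) ≤ 28 := by
  have e0 : pderiv 0 F = C 4 * X 0 ^ 3 + (C 2 * f₂ * X 0 + f₃) := by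
    rw [hF]
    simp only [map_add, pderiv_mul, pderiv_pow, pderiv_X_self, pderiv_zero f₂ h₂x,
      pderiv_zero f₃ h₃x, pderiv_zero f₄ h₄x]
    have : (C 4 : MvPolynomial (Fin 4) k) = 4 := map_ofNat C 4
    have : (C 2 : MvPolynomial (Fin 4) k) = 2 := map_ofNat C 2
    simp [*]; ring
  have e1 : pderiv 1 F = pderiv 1 f₂ * X 0 ^ 2 + pderiv 1 f₃ * X 0 + pderiv 1 f₄ := by
    rw [hF]
    have : pderiv (1 : Fin 4) (X 0 : MvPolynomial (Fin 4) k) = 0 :=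
      pderiv_X_of_ne (by decide)
    simp only [map_add, pderiv_mul, pderiv_pow, this]
    ring
  have hX : degreeOf 0 (X 0 : MvPolynomial (Fin 4) k) = 1 := by simp
  have hXp : ∀ n, degreeOf 0 (X 0 ^ n : MvPolynomial (Fin 4) k) = n := by
    intro n; rw [degreeOf_pow_eq _ _ _ (X_ne_zero 0), hX, mul_one]
  have hC4 : (C 4 : MvPolynomial (Fin 4) k) ≠ 0 := by simp
  have d0 : degreeOf 0 (pderiv 0 F) = 3 := by
    have a : degreeOf 0 (C 4 * X 0 ^ 3 : MvPolynomial (Fin 4) k) = 3 := by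
      rw [degreeOf_mul_eq hC4 (pow_ne_zero _ (X_ne_zero 0)), hXp, degreeOf_C]
    have b : degreeOf 0 (C 2 * f₂ * X 0 + f₃) ≤ 1 := by
      refine (degreeOf_add_le _ _ _).trans (max_le ?_ (by rw [deg_zero_s9 f₃ h₃x]; omega))
      have u := degreeOf_mul_le 0 (C 2 * f₂) (X 0)
      have v := degreeOf_mul_le 0 (C 2) f₂
      rw [deg_zero_s9 f₂ h₂x, degreeOf_C] at v
      rw [hX] at u
      omega
    rw [e0, degreeOf_add_eq_of_degreeOf_lt (by omega), a]
  have d1 : degreeOf 0 (pderiv 1 F) ≤ 2 := by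
    have g2 := deg_zero_s9 _ (pderiv_deg f₂ h₂x)
    have g3 := deg_zero_s9 _ (pderiv_deg f₃ h₃x)
    have g4 := deg_zero_s9 _ (pderiv_deg f₄ h₄x)
    have u := degreeOf_mul_le 0 (pderiv 1 f₂) (X 0 ^ 2)
    have v := degreeOf_mul_le 0 (pderiv 1 f₃) (X 0)
    rw [hXp] at u
    rw [hX] at v
    rw [e1]
    refine (degreeOf_add_le _ _ _).trans (max_le ((degreeOf_add_le _ _ _).trans
      (max_le ?_ ?_)) ?_) <;> omega
  have hFh : F.IsHomogeneous 4 := by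
    rw [hF]
    have x := fun n => isHomogeneous_X_pow (R := k) (0 : Fin 4) n
    refine (((x 4).add (h₂.mul (x 2))).add ?_).add h₄
    exact h₃.mul (isHomogeneous_X k 0)
  have hmemH : ∀ i j, (X i * pderiv j F).IsHomogeneous 4 := fun i j =>
    (isHomogeneous_X k i).mul (hFh.pderiv (i := j))
  have hli : LinearIndependent k
      ![X 0 * pderiv 0 F, X 1 * pderiv 0 F, X 2 * pderiv 0 F, X 3 * pderiv 0 F,
        X 1 * pderiv 1 F, X 2 * pderiv 1 F, X 3 * pderiv 1 F] := by
    rw [Fintype.linearIndependent_iff]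
    intro g hg
    simp only [Fin.sum_univ_seven, MvPolynomial.smul_eq_C_mul] at hg
    set L : MvPolynomial (Fin 4) k :=
      C (g 0) * X 0 + C (g 1) * X 1 + C (g 2) * X 2 + C (g 3) * X 3 with hL
    set B : MvPolynomial (Fin 4) k :=
      C 0 * X 0 + C (g 4) * X 1 + C (g 5) * X 2 + C (g 6) * X 3 with hB
    have hrel : L * pderiv 0 F = -(B * pderiv 1 F) := by
      rw [eq_neg_iff_add_eq_zero, ← hg, hL, hB, C_0]
      simp
      ring
    have n0 : pderiv 0 F ≠ 0 := by
      intro h; rw [h] at d0; simp at d0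
    have hBd : degreeOf 0 B = 0 := by
      have t : ∀ (c : k) (i : Fin 4), i ≠ 0 → degreeOf 0 (C c * X i) = 0 := by
        intro c i hi
        have := degreeOf_mul_le 0 (C c) (X i)
        rw [degreeOf_C, degreeOf_X, if_neg hi.symm] at this
        omega
      have hadd : ∀ p q : MvPolynomial (Fin 4) k, degreeOf 0 p = 0 → degreeOf 0 q = 0 →
          degreeOf 0 (p + q) = 0 := by
        intro p q hp hq
        have := degreeOf_add_le 0 p q
        rw [hp, hq] at this
        simpa using this
      rw [hB, C_0, zero_mul, zero_add]
      exact hadd _ _ (hadd _ _ (t _ _ (by decide)) (t _ _ (by decide))) (t _ _ (by decide))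
    have hL0 : L = 0 := by
      by_contra hne
      have h3 := degreeOf_mul_eq (n := 0) hne n0
      have h4 := degreeOf_mul_le 0 (-B) (pderiv 1 F)
      rw [hrel, d0] at h3
      rw [neg_mul, h3, degreeOf_neg, hBd] at h4
      omega
    have hB0 : B = 0 := by
      rw [hL0, zero_mul, eq_comm, neg_eq_zero] at hrel
      exact (mul_eq_zero.mp hrel).resolve_right h1
    obtain ⟨a0, a1, a2, a3⟩ := lin_zero ![g 0, g 1, g 2, g 3] (by simpa [hL] using hL0)
    obtain ⟨-, b1, b2, b3⟩ := lin_zero ![0, g 4, g 5, g 6] (by simpa [hB] using hB0)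
    intro i
    fin_cases i
    exacts [a0, a1, a2, a3, b1, b2, b3]
  refine ⟨hli, ?_⟩
  obtain ⟨hfin, hle⟩ := hom_finite k
  set v := ![X 0 * pderiv 0 F, X 1 * pderiv 0 F, X 2 * pderiv 0 F, X 3 * pderiv 0 F,
        X 1 * pderiv 1 F, X 2 * pderiv 1 F, X 3 * pderiv 1 F] with hv
  have hvm : ∀ i, ∃ a b, v i = X a * pderiv b F := by
    intro i
    fin_cases i
    exacts [⟨0, 0, rfl⟩, ⟨1, 0, rfl⟩, ⟨2, 0, rfl⟩, ⟨3, 0, rfl⟩, ⟨1, 1, rfl⟩, ⟨2, 1, rfl⟩,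
      ⟨3, 1, rfl⟩]
  have hvH : ∀ i, v i ∈ homogeneousSubmodule (Fin 4) k 4 := by
    intro i
    obtain ⟨a, b, h⟩ := hvm i
    rw [h]; exact hmemH a b
  have hvW : ∀ i, v i ∈ W := by
    intro i
    rw [hW]
    exact Submodule.subset_span (hvm i)
  let w : Fin 7 → W.comap (homogeneousSubmodule (Fin 4) k 4).subtype :=
    fun i => ⟨⟨v i, hvH i⟩, hvW i⟩
  have hw : LinearIndependent k w := by
    apply LinearIndependent.of_comp ((homogeneousSubmodule (Fin 4) k 4).subtype ∘ₗ
      (W.comap (homogeneousSubmodule (Fin 4) k 4).subtype).subtype)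
    exact hli
  have h7 := hw.fintype_card_le_finrank
  rw [Fintype.card_fin] at h7
  have := Submodule.finrank_quotient_add_finrank
    (W.comap (homogeneousSubmodule (Fin 4) k 4).subtype)
  omega
end
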